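/- In the Li–Du–Massar quantum Cournot duopoly with refined payoffs and zero marginal cost (c = 0, a > 0, γ ≥ 0), every strategy profile (x1*, x2*) with x1* ≥ a·e^{−γ} and x2* ≥ a·e^{−γ} is a Nash equilibrium, and at every such equilibrium both players receive payoff 0. -/

import Mathlib

/-- Player 1's payoff in the Li–Du–Massar quantum Cournot duopoly with refined payoffs
and zero marginal cost. -/
noncomputable def uQ1 (a γ x1 x2 : ℝ) : ℝ :=
  if Real.exp γ * (x1 + x2) ≤ a then
    (x1 * Real.cosh γ + x2 * Real.sinh γ) * (a - Real.exp γ * (x1 + x2))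
  else 0

/-- Player 2's payoff in the Li–Du–Massar quantum Cournot duopoly with refined payoffs
and zero marginal cost. -/
noncomputable def uQ2 (a γ x1 x2 : ℝ) : ℝ :=
  if Real.exp γ * (x1 + x2) ≤ a then
    (x2 * Real.cosh γ + x1 * Real.sinh γ) * (a - Real.exp γ * (x1 + x2))
  else 0

theorem uQ2_eq_uQ1_swap (a γ x1 x2 : ℝ) : uQ2 a γ x1 x2 = uQ1 a γ x2 x1 := by
  simp only [uQ1, uQ2, add_comm x1 x2]

/-- If the opponent's quantity alone already reaches the market saturation level
`a·e^{-γ}`, then player 1's payoff vanishes. -/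
theorem uQ1_eq_zero_of_opponent_ge {a γ x1 x2 : ℝ} (hx1 : 0 ≤ x1)
    (hx2 : a * Real.exp (-γ) ≤ x2) : uQ1 a γ x1 x2 = 0 := by
  unfold uQ1
  split_ifs with h
  · have hx1' : 0 ≤ Real.exp γ * x1 := by positivity
    have hx2' : a ≤ Real.exp γ * x2 := by
      rwa [Real.exp_neg, ← div_eq_mul_inv, div_le_iff₀' (Real.exp_pos γ)] at hx2
    have hsum : a - Real.exp γ * (x1 + x2) = 0 := by linarith
    rw [hsum, mul_zero]
  · rfl

/-- With zero marginal cost, every profile `(x1s, x2s)` with `x1s ≥ a·e^{-γ}` and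
`x2s ≥ a·e^{-γ}` is a Nash equilibrium of the Li–Du–Massar quantum Cournot duopoly with
refined payoffs, and both players receive payoff 0. -/
theorem li_du_massar_zero_cost_equilibria (a γ : ℝ) (ha : 0 < a) (hγ : 0 ≤ γ) :
    ∀ x1s x2s : ℝ, a * Real.exp (-γ) ≤ x1s → a * Real.exp (-γ) ≤ x2s →
      ((∀ x1 : ℝ, 0 ≤ x1 → uQ1 a γ x1 x2s ≤ uQ1 a γ x1s x2s) ∧
       (∀ x2 : ℝ, 0 ≤ x2 → uQ2 a γ x1s x2 ≤ uQ2 a γ x1s x2s)) ∧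
      uQ1 a γ x1s x2s = 0 ∧ uQ2 a γ x1s x2s = 0 := by
  intro x1s x2s h1 h2
  have h0 : 0 ≤ a * Real.exp (-γ) := by positivity
  have hu1 : ∀ x1 : ℝ, 0 ≤ x1 → uQ1 a γ x1 x2s = 0 := fun _ hx =>
    uQ1_eq_zero_of_opponent_ge hx h2
  have hu2 : ∀ x2 : ℝ, 0 ≤ x2 → uQ2 a γ x1s x2 = 0 := fun _ hx =>
    (uQ2_eq_uQ1_swap ..).trans (uQ1_eq_zero_of_opponent_ge hx h1)
  have hs1 := hu1 x1s (h0.trans h1)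
  have hs2 := hu2 x2s (h0.trans h2)
  exact ⟨⟨fun x1 hx => by rw [hu1 x1 hx, hs1], fun x2 hx => by rw [hu2 x2 hx, hs2]⟩, hs1, hs2⟩
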